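/- Let P ∈ H with g(P,P) = m² and m > 0. Then Ψ ∈ W^{{2j}} solves the generalized algebraic Dirac equation γ̌[P]Ψ = mΨ if and only if Ψ is uniquely determined by its component Ψ^{(2j,0)} ∈ Sym_{2j}(U) via repeated application of (1/m)·γ̌[P]; in particular the solution space is linearly isomorphic to Sym_{2j}(U), hence has complex dimension 2j+1. -/

import Mathlib

open Matrix MvPolynomial

noncomputable section

abbrev U2 := Fin 2 → ℂ
abbrev M2 := Matrix (Fin 2) (Fin 2) ℂ

def epsBil (c : ℂ) (u v : U2) : ℂ := c * (u 0 * v 1 - u 1 * v 0)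

def epsLow (c : ℂ) : M2 := c • !![0, 1; -1, 0]

def outerH (u : U2) : M2 := fun A B => u A * star (u B)

def IsHerm (M : M2) : Prop := Mᴴ = M

/-- Index lowering `P_{AȦ} = ε_{BA}·conj(ε)_{ḂȦ}·P^{BḂ}`. -/
def lowerT (c : ℂ) (P : M2) : M2 :=
  fun ad bd => ∑ a, ∑ b, epsLow c a ad * star (epsLow c b bd) * P a b

/-- Spinor sectors are modelled by polynomials: a symmetric spinor with h
undotted and k dotted indices corresponds to a polynomial of bidegree (h,k) in
the variables `x_A = X (inl A)` (for U) and `y_Ȧ = X (inr Ȧ)` (for conj(U)*). -/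
abbrev PolyW := MvPolynomial (Fin 2 ⊕ Fin 2) ℂ

def wgt : Fin 2 ⊕ Fin 2 → ℕ × ℕ :=
  Sum.elim (fun _ => (1, 0)) (fun _ => (0, 1))

/-- The extended bundle `W^{{r}}` has 2r sectors, cyclically ordered:
`U^{(r,0)}, U^{(r−1,1)}, …, U^{(0,r)} = Ũ^{(r,0)}, Ũ^{(r−1,1)}, …, Ũ^{(1,r−1)}`.
The sector `s` has `xdeg r s` U-type indices. -/
def xdeg (r : ℕ) (s : Fin (2 * r)) : ℕ :=
  if (s : ℕ) ≤ r then r - s else s - r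

/-- The sector `s` of `W^{{r}}`, as a subspace of polynomials. -/
def sector (r : ℕ) (s : Fin (2 * r)) : Submodule ℂ PolyW :=
  weightedHomogeneousSubmodule ℂ wgt (xdeg r s, r - xdeg r s)

/-- Cyclic successor of a sector index. -/
def nxt {r : ℕ} (s : Fin (2 * r)) : Fin (2 * r) :=
  ⟨((s : ℕ) + 1) % (2 * r), Nat.mod_lt _ (lt_of_le_of_lt (Nat.zero_le _) s.isLt)⟩

/-- The symmetrized Dirac map `γ̌[P]` from sector s to sector (s+1).  On
U-type sectors it contracts one undotted index with `P_{AȦ}` and symmetrizes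
the dotted indices (in the polynomial model: `√2/h · Σ P_{AȦ} y_Ȧ ∂_{x_A}`);
on Ũ-type sectors it contracts one dotted index with `P^{AȦ}`
(`√2/h' · Σ P^{AȦ} x_A ∂_{y_Ȧ}`). -/
def gammaOp (c : ℂ) (P : M2) (r : ℕ) (s : Fin (2 * r)) (p : PolyW) : PolyW :=
  if (s : ℕ) < r then
    ((Real.sqrt 2 : ℂ) * ((r - (s : ℕ) : ℕ) : ℂ)⁻¹) •
      ∑ A, ∑ B, lowerT c P A B • (X (Sum.inr B) * pderiv (Sum.inl A) p)
  else
    ((Real.sqrt 2 : ℂ) * ((2 * r - (s : ℕ) : ℕ) : ℂ)⁻¹) •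
      ∑ A, ∑ B, P A B • (X (Sum.inl A) * pderiv (Sum.inr B) p)

/-- Solutions of the generalized algebraic Dirac equation `γ̌[P]Ψ = mΨ` on
`W^{{r}}`: families of sector components of the right bidegrees satisfying
the sector-to-sector equations. -/
def Sol (c : ℂ) (P : M2) (m : ℝ) (r : ℕ) : Set (Fin (2 * r) → PolyW) :=
  {Ψ | (∀ s, Ψ s ∈ sector r s) ∧
       ∀ s, gammaOp c P r s (Ψ s) = (m : ℂ) • Ψ (nxt s)}

/-- The homogeneous linear vector field `∑ N A B · X (i B) · ∂/∂X (j A)`. -/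
def contraction {ι : Type*} (N : M2) (i j : Fin 2 → ι) :
    Derivation ℂ (MvPolynomial ι ℂ) (MvPolynomial ι ℂ) :=
  ∑ A, ∑ B, N A B • (X (i B) : MvPolynomial ι ℂ) • pderiv (j A)

lemma contraction_apply {ι : Type*} (N : M2) (i j : Fin 2 → ι) (p : MvPolynomial ι ℂ) :
    contraction N i j p = ∑ A, ∑ B, N A B • (X (i B) * pderiv (j A) p) := by
  simp [contraction]

section Derivation

variable {ι : Type*} (D : Derivation ℂ (MvPolynomial ι ℂ) (MvPolynomial ι ℂ))

lemma derivation_iterate_mul (q f : MvPolynomial ι ℂ) (hf : D (D f) = 0) (n : ℕ) :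
    D^[n + 1] (q * f) = D^[n + 1] q * f + ((n : ℂ) + 1) • (D^[n] q * D f) := by
  induction n with
  | zero => simp [D.leibniz]; ring
  | succ n ih =>
    rw [Function.iterate_succ_apply', ih]
    simp only [Function.iterate_succ_apply', map_add, D.map_smul, D.leibniz, hf, smul_eq_mul,
      mul_zero, zero_add]
    push_cast
    simp only [smul_eq_C_mul, map_add, map_one]
    ring

lemma derivation_iterate_mul_of_eq_zero (q f : MvPolynomial ι ℂ) (hf : D f = 0) (n : ℕ) :
    D^[n] (q * f) = D^[n] q * f := by
  cases n with
  | zero => rfl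
  | succ n => rw [derivation_iterate_mul D q f (by rw [hf, map_zero])]; simp [hf]

/-- A derivation which kills the variables of weight `0` and whose square kills the variables of
weight `1` acts, after `n`-fold iteration on polynomials of weight `n`, as `n!` times a
substitution of variables. -/
lemma derivation_iterate_eq_factorial_smul (w : ι → ℕ)
    (σ : MvPolynomial ι ℂ →ₐ[ℂ] MvPolynomial ι ℂ)
    (h : ∀ i, (w i = 0 ∧ D (X i) = 0 ∧ σ (X i) = X i) ∨
      (w i = 1 ∧ D (D (X i)) = 0 ∧ σ (X i) = D (X i)))
    {p : MvPolynomial ι ℂ} {n : ℕ} (hp : IsWeightedHomogeneous w p n) :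
    D^[n] p = (n.factorial : ℂ) • σ p := by
  have key : ∀ d a, ∃ n, IsWeightedHomogeneous w (monomial d a : MvPolynomial ι ℂ) n ∧
      D^[n] (monomial d a) = (n.factorial : ℂ) • σ (monomial d a) ∧
      D^[n + 1] (monomial d a) = 0 := by
    refine induction_on_monomial (motive := fun p => ∃ n, IsWeightedHomogeneous w p n ∧
      D^[n] p = (n.factorial : ℂ) • σ p ∧ D^[n + 1] p = 0) ?_ ?_
    · intro a
      refine ⟨0, isWeightedHomogeneous_C w a, ?_, ?_⟩
      · simp only [Function.iterate_zero, id, Nat.factorial_zero, Nat.cast_one, one_smul]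
        exact (σ.commutes a).symm
      · simp
    · rintro q i ⟨n, hq, h1, h2⟩
      rcases h i with ⟨hw, hD, hσ⟩ | ⟨hw, hD, hσ⟩
      · refine ⟨n, ?_, ?_, ?_⟩
        · simpa [hw] using hq.mul (isWeightedHomogeneous_X ℂ w i)
        · rw [derivation_iterate_mul_of_eq_zero D q _ hD, h1, map_mul, hσ, smul_mul_assoc]
        · rw [derivation_iterate_mul_of_eq_zero D q _ hD, h2, zero_mul]
      · refine ⟨n + 1, ?_, ?_, ?_⟩
        · simpa [hw] using hq.mul (isWeightedHomogeneous_X ℂ w i)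
        · rw [derivation_iterate_mul D q _ hD, h2, h1, map_mul, hσ, zero_mul, zero_add,
            smul_mul_assoc, smul_smul, Nat.factorial_succ]
          push_cast
          rfl
        · rw [derivation_iterate_mul D q _ hD, Function.iterate_succ_apply', h2]
          simp
  have hlin : ∀ (s : Finset (ι →₀ ℕ)) (f : (ι →₀ ℕ) → MvPolynomial ι ℂ) (n : ℕ),
      D^[n] (∑ d ∈ s, f d) = ∑ d ∈ s, D^[n] (f d) := by
    intro s f n
    induction n with
    | zero => rfl
    | succ n ih => simp only [Function.iterate_succ_apply', ih, map_sum]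
  rw [p.as_sum, hlin, map_sum, Finset.smul_sum]
  refine Finset.sum_congr rfl fun d hd => ?_
  obtain ⟨k, hk, hk', -⟩ := key d (coeff d p)
  have hne : (monomial d (coeff d p) : MvPolynomial ι ℂ) ≠ 0 := by
    simpa using hd
  have : k = n := hk.inj_right hne
    (isWeightedHomogeneous_monomial w d _ (hp (mem_support_iff.mp hd)))
  rw [← this, hk']

lemma eq_smul_iterate_of_recurrence (a : ℂ) (r : ℕ) (G : ℕ → MvPolynomial ι ℂ)
    (hG : ∀ k < r, G (k + 1) = (a * ((r - k : ℕ) : ℂ)⁻¹) • D (G k)) :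
    G r = (a ^ r * (r.factorial : ℂ)⁻¹) • D^[r] (G 0) := by
  have key : ∀ k ≤ r, G k =
      (a ^ k * ((r - k).factorial * (r.factorial : ℂ)⁻¹)) • D^[k] (G 0) := by
    intro k
    induction k with
    | zero =>
      intro _
      have : (r.factorial : ℂ) ≠ 0 := by exact_mod_cast r.factorial_ne_zero
      simp [this]
    | succ k ih =>
      intro hk
      rw [hG k hk, ih (by omega), D.map_smul, smul_smul, Function.iterate_succ_apply']
      congr 1
      have h1 : r - k = (r - (k + 1)) + 1 := by omega
      rw [h1, Nat.factorial_succ]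
      have h2 : (((r - (k + 1) + 1 : ℕ)) : ℂ) ≠ 0 := by exact_mod_cast Nat.succ_ne_zero (r - (k + 1))
      push_cast at h2 ⊢
      field_simp
      ring
  simpa using key r le_rfl

end Derivation

lemma weight_wgt (d : Fin 2 ⊕ Fin 2 →₀ ℕ) : Finsupp.weight wgt d =
    (d (Sum.inl 0) + d (Sum.inl 1), d (Sum.inr 0) + d (Sum.inr 1)) := by
  ext <;> simp [Finsupp.weight_eq_sum, Fin.sum_univ_two, wgt]

lemma isWeightedHomogeneous_fst {p : PolyW} {a b : ℕ} (hp : IsWeightedHomogeneous wgt p (a, b)) :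
    IsWeightedHomogeneous (fun i => (wgt i).1) p a := by
  intro d hd
  have := congrArg Prod.fst (hp hd)
  simpa [Finsupp.weight_eq_sum] using this

lemma isWeightedHomogeneous_snd {p : PolyW} {a b : ℕ} (hp : IsWeightedHomogeneous wgt p (a, b)) :
    IsWeightedHomogeneous (fun i => (wgt i).2) p b := by
  intro d hd
  have := congrArg Prod.snd (hp hd)
  simpa [Finsupp.weight_eq_sum] using this

lemma contraction_inl_isWeightedHomogeneous (N : M2) {p : PolyW} {a b : ℕ}
    (hp : IsWeightedHomogeneous wgt p (a + 1, b)) :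
    IsWeightedHomogeneous wgt (contraction N Sum.inr Sum.inl p) (a, b + 1) := by
  rw [contraction_apply]
  refine IsWeightedHomogeneous.sum _ _ _ fun A _ => IsWeightedHomogeneous.sum _ _ _ fun B _ => ?_
  refine (weightedHomogeneousSubmodule ℂ wgt (a, b + 1)).smul_mem _ ?_
  have h1 : (pderiv (Sum.inl A) p).IsWeightedHomogeneous wgt (a, b) :=
    hp.pderiv (by simp [wgt])
  have h2 := (isWeightedHomogeneous_X ℂ wgt (Sum.inr B)).mul h1
  have h3 : wgt (Sum.inr B) + (a, b) = (a, b + 1) := by simp [wgt, add_comm]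
  exact h3 ▸ h2

lemma contraction_inr_isWeightedHomogeneous (N : M2) {p : PolyW} {a b : ℕ}
    (hp : IsWeightedHomogeneous wgt p (a, b + 1)) :
    IsWeightedHomogeneous wgt (contraction N Sum.inl Sum.inr p) (a + 1, b) := by
  rw [contraction_apply]
  refine IsWeightedHomogeneous.sum _ _ _ fun A _ => IsWeightedHomogeneous.sum _ _ _ fun B _ => ?_
  refine (weightedHomogeneousSubmodule ℂ wgt (a + 1, b)).smul_mem _ ?_
  have h1 : (pderiv (Sum.inr A) p).IsWeightedHomogeneous wgt (a, b) :=
    hp.pderiv (by simp [wgt])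
  have h2 := (isWeightedHomogeneous_X ℂ wgt (Sum.inl B)).mul h1
  have h3 : wgt (Sum.inl B) + (a, b) = (a + 1, b) := by simp [wgt, add_comm]
  exact h3 ▸ h2

lemma gammaOp_of_lt (c : ℂ) (P : M2) (r : ℕ) (s : Fin (2 * r)) (p : PolyW) (hs : (s : ℕ) < r) :
    gammaOp c P r s p = ((Real.sqrt 2 : ℂ) * ((r - (s : ℕ) : ℕ) : ℂ)⁻¹) •
      contraction (lowerT c P) Sum.inr Sum.inl p := by
  rw [contraction_apply, gammaOp, if_pos hs]

lemma gammaOp_of_le (c : ℂ) (P : M2) (r : ℕ) (s : Fin (2 * r)) (p : PolyW) (hs : r ≤ (s : ℕ)) :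
    gammaOp c P r s p = ((Real.sqrt 2 : ℂ) * ((2 * r - (s : ℕ) : ℕ) : ℂ)⁻¹) •
      contraction Pᵀ Sum.inl Sum.inr p := by
  rw [contraction_apply, gammaOp, if_neg (by omega), Finset.sum_comm]
  simp only [Matrix.transpose_apply]

lemma gammaOp_mem_sector (c : ℂ) (P : M2) (r : ℕ) (s : Fin (2 * r)) {p : PolyW}
    (hp : p ∈ sector r s) : gammaOp c P r s p ∈ sector r (nxt s) := by
  have hs := s.isLt
  rw [sector, mem_weightedHomogeneousSubmodule] at hp
  rcases lt_or_ge (s : ℕ) r with h | h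
  · rw [gammaOp_of_lt _ _ _ _ _ h]
    refine Submodule.smul_mem _ _ ?_
    have hn : ((nxt s : Fin (2 * r)) : ℕ) = s + 1 := Nat.mod_eq_of_lt (by omega)
    have e1 : (xdeg r s, r - xdeg r s) = ((r - (s + 1)) + 1, (s : ℕ)) := by
      rw [xdeg, if_pos h.le, Prod.mk.injEq]; omega
    have e2 : (xdeg r (nxt s), r - xdeg r (nxt s)) = (r - (s + 1), (s : ℕ) + 1) := by
      rw [xdeg, hn, if_pos (by omega), Prod.mk.injEq]; omega
    rw [sector, e2]
    rw [e1] at hp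
    exact contraction_inl_isWeightedHomogeneous _ hp
  · rw [gammaOp_of_le _ _ _ _ _ h]
    refine Submodule.smul_mem _ _ ?_
    have e1 : (xdeg r s, r - xdeg r s) = ((s : ℕ) - r, (2 * r - (s + 1)) + 1) := by
      rw [xdeg, Prod.mk.injEq]; split_ifs <;> omega
    have e2 : (xdeg r (nxt s), r - xdeg r (nxt s)) = ((s : ℕ) - r + 1, 2 * r - (s + 1)) := by
      have hn : ((nxt s : Fin (2 * r)) : ℕ) = (s + 1) % (2 * r) := rfl
      rw [xdeg, hn, Prod.mk.injEq]
      rcases lt_or_ge ((s : ℕ) + 1) (2 * r) with h' | h'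
      · rw [Nat.mod_eq_of_lt h']; split_ifs <;> omega
      · have : (s : ℕ) + 1 = 2 * r := by omega
        rw [this, Nat.mod_self]; simp; omega
    rw [sector, e2]
    rw [e1] at hp
    exact contraction_inr_isWeightedHomogeneous _ hp

/-- The algebra map replacing the undotted variables by linear forms in the dotted ones. -/
def substInl (N : M2) : PolyW →ₐ[ℂ] PolyW :=
  aeval (Sum.elim (fun A => ∑ B, N A B • X (Sum.inr B)) (fun A => X (Sum.inr A)))

/-- The algebra map replacing the dotted variables by linear forms in the undotted ones. -/
def substInr (N : M2) : PolyW →ₐ[ℂ] PolyW :=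
  aeval (Sum.elim (fun A => X (Sum.inl A)) (fun A => ∑ B, N A B • X (Sum.inl B)))

lemma contraction_inl_iterate (N : M2) {p : PolyW} {a b : ℕ}
    (hp : IsWeightedHomogeneous wgt p (a, b)) :
    (contraction N Sum.inr Sum.inl)^[a] p = (a.factorial : ℂ) • substInl N p := by
  refine derivation_iterate_eq_factorial_smul _ _ _ ?_ (isWeightedHomogeneous_fst hp)
  rintro (A | A)
  · right
    fin_cases A <;>
      simp [wgt, contraction_apply, substInl, Fin.sum_univ_two, pderiv_X, Pi.single_apply]
  · left
    simp [wgt, contraction_apply, substInl, pderiv_X]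

lemma contraction_inr_iterate (N : M2) {p : PolyW} {a b : ℕ}
    (hp : IsWeightedHomogeneous wgt p (a, b)) :
    (contraction N Sum.inl Sum.inr)^[b] p = (b.factorial : ℂ) • substInr N p := by
  refine derivation_iterate_eq_factorial_smul _ _ _ ?_ (isWeightedHomogeneous_snd hp)
  rintro (A | A)
  · left
    simp [wgt, contraction_apply, substInr, pderiv_X]
  · right
    fin_cases A <;>
      simp [wgt, contraction_apply, substInr, Fin.sum_univ_two, pderiv_X, Pi.single_apply]

/-- If an algebra map scales the undotted variables by `κ`, it scales `Sym_r(U)` by `κ ^ r`. -/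
lemma algHom_apply_of_scaling (κ : ℂ) (φ : PolyW →ₐ[ℂ] PolyW)
    (hφ : ∀ A, φ (X (Sum.inl A)) = κ • X (Sum.inl A)) {p : PolyW} {r : ℕ}
    (hp : IsWeightedHomogeneous wgt p (r, 0)) : φ p = κ ^ r • p := by
  conv_lhs => rw [p.as_sum]
  conv_rhs => rw [p.as_sum]
  rw [map_sum, Finset.smul_sum]
  refine Finset.sum_congr rfl fun d hd => ?_
  have hw := hp (mem_support_iff.mp hd)
  simp only [weight_wgt, Prod.mk.injEq, Nat.add_eq_zero_iff] at hw
  obtain ⟨h1, h2, h3⟩ := hw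
  rw [monomial_eq, map_mul, Finsupp.prod_fintype _ _ (by simp)]
  simp only [Fintype.prod_sum_type, Fin.prod_univ_two, map_mul, map_pow, h2, h3, pow_zero, mul_one,
    hφ, ← h1, pow_add, smul_eq_C_mul]
  rw [show φ (C (coeff d p)) = C (coeff d p) from φ.commutes _]
  ring

lemma substInr_substInl (c : ℂ) (P : M2) {p : PolyW} {r : ℕ}
    (hp : IsWeightedHomogeneous wgt p (r, 0)) :
    substInr Pᵀ (substInl (lowerT c P) p) = (c * star c * P.det) ^ r • p := by
  refine algHom_apply_of_scaling _ ((substInr Pᵀ).comp (substInl (lowerT c P))) ?_ hp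
  intro A
  fin_cases A <;>
  · simp [substInr, substInl, lowerT, epsLow, Fin.sum_univ_two, Matrix.det_fin_two, smul_eq_C_mul]
    ring

/-- The Lorentzian form is determined by its values on null vectors: it is the polarized
determinant. -/
lemma form_self_eq_det (c : ℂ) (g : M2 → M2 → ℂ)
    (hg1 : ∀ M N P : M2, g (M + N) P = g M P + g N P)
    (hg2 : ∀ M N P : M2, g M (N + P) = g M N + g M P)
    (hg3 : ∀ (t : ℝ) (M N : M2), g (t • M) N = t • g M N)
    (hg4 : ∀ (t : ℝ) (M N : M2), g M (t • N) = t • g M N)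
    (hg : ∀ u v : U2, g (outerH u) (outerH v) = epsBil c u v * star (epsBil c u v))
    (P : M2) (hP : IsHerm P) : g P P = 2 * (c * star c * P.det) := by
  have h00 : star (P 0 0) = P 0 0 := congrFun (congrFun hP 0) 0
  have h11 : star (P 1 1) = P 1 1 := congrFun (congrFun hP 1) 1
  have h10 : star (P 0 1) = P 1 0 := congrFun (congrFun hP 1) 0
  have e00 : P 0 0 = ((P 0 0).re : ℂ) := (Complex.conj_eq_iff_re.mp h00).symm
  have e11 : P 1 1 = ((P 1 1).re : ℂ) := (Complex.conj_eq_iff_re.mp h11).symm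
  obtain ⟨a, ha⟩ : ∃ a : ℝ, P 0 0 = a := ⟨_, e00⟩
  obtain ⟨d, hd⟩ : ∃ d : ℝ, P 1 1 = d := ⟨_, e11⟩
  obtain ⟨x, y, hxy⟩ : ∃ x y : ℝ, P 0 1 = x - y * Complex.I :=
    ⟨(P 0 1).re, -(P 0 1).im, by apply Complex.ext <;> simp⟩
  have hyx : P 1 0 = x + y * Complex.I := by rw [← h10, hxy]; simp
  have hdec : P = (a - x - y) • outerH ![1, 0] + (d - x - y) • outerH ![0, 1]
      + x • outerH ![1, 1] + y • outerH ![1, Complex.I] := by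
    ext i j
    fin_cases i <;> fin_cases j <;>
      simp [outerH, ha, hd, hxy, hyx] <;> ring
  have hdet : P.det = a * d - (x ^ 2 + y ^ 2) := by
    rw [Matrix.det_fin_two, ha, hd, hxy, hyx]
    linear_combination (y : ℂ) ^ 2 * Complex.I_sq
  rw [hdet, hdec]
  simp only [hg1, hg2, hg3, hg4, hg, epsBil]
  simp
  ring_nf
  simp only [Complex.I_sq]
  ring

lemma finrank_weightedHomogeneousSubmodule_wgt (r : ℕ) :
    Module.finrank ℂ (weightedHomogeneousSubmodule ℂ wgt (r, 0)) = r + 1 := by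
  let e : Fin (r + 1) ≃ {d : Fin 2 ⊕ Fin 2 →₀ ℕ | Finsupp.weight wgt d = (r, 0)} :=
    { toFun := fun k => ⟨Finsupp.single (Sum.inl 0) (k : ℕ) +
          Finsupp.single (Sum.inl 1) (r - (k : ℕ)), by
        have := k.isLt
        simp only [Set.mem_ofPred_eq, weight_wgt]
        simp
        omega⟩
      invFun := fun d => ⟨d.1 (Sum.inl 0), by
        have h := d.2
        simp only [Set.mem_ofPred_eq, weight_wgt, Prod.mk.injEq] at h
        omega⟩
      left_inv := fun k => by ext; simp
      right_inv := fun d => by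
        have h := d.2
        simp only [Set.mem_ofPred_eq, weight_wgt, Prod.mk.injEq] at h
        ext i
        rcases i with i | i <;> fin_cases i <;> simp <;> omega }
  rw [weightedHomogeneousSubmodule_eq_finsupp_supported]
  let := Fintype.ofEquiv _ e
  rw [(AddMonoidAlgebra.supportedEquivFinsupp (R := ℂ) (S := ℂ)
    {d : Fin 2 ⊕ Fin 2 →₀ ℕ | Finsupp.weight wgt d = (r, 0)}).finrank_eq,
    Module.finrank_finsupp_self, ← Fintype.card_congr e, Fintype.card_fin]

/-- The sequence of sector components generated from `q` by repeated application of
`(1/m)·γ̌[P]`. -/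
def diracOrbit (c : ℂ) (P : M2) (m : ℝ) (r : ℕ) (q : PolyW) : ℕ → PolyW
  | 0 => q
  | n + 1 => if h : n < 2 * r then (m : ℂ)⁻¹ • gammaOp c P r ⟨n, h⟩ (diracOrbit c P m r q n) else 0

lemma diracOrbit_succ (c : ℂ) (P : M2) (m : ℝ) (r : ℕ) (q : PolyW) (n : ℕ) (h : n < 2 * r) :
    diracOrbit c P m r q (n + 1) = (m : ℂ)⁻¹ • gammaOp c P r ⟨n, h⟩ (diracOrbit c P m r q n) := by
  rw [diracOrbit, dif_pos h]

lemma diracOrbit_mem_sector (c : ℂ) (P : M2) (m : ℝ) (r : ℕ) {q : PolyW}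
    (hq : IsWeightedHomogeneous wgt q (r, 0)) (n : ℕ) (h : n < 2 * r) :
    diracOrbit c P m r q n ∈ sector r ⟨n, h⟩ := by
  induction n with
  | zero => simpa [sector, xdeg, diracOrbit] using hq
  | succ n ih =>
    rw [diracOrbit_succ c P m r q n (by omega)]
    refine Submodule.smul_mem _ _ ?_
    have hn : nxt ⟨n, by omega⟩ = (⟨n + 1, h⟩ : Fin (2 * r)) := Fin.ext (Nat.mod_eq_of_lt h)
    exact hn ▸ gammaOp_mem_sector c P r _ (ih (by omega))

/-- Running once around the cycle of sectors gives back the initial component. -/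
lemma diracOrbit_two_mul (c : ℂ) (P : M2) (m : ℝ) (hm : 0 < m) (r : ℕ) (hr : 0 < r)
    (hdet : 2 * (c * star c * P.det) = (m : ℂ) ^ 2) {q : PolyW}
    (hq : IsWeightedHomogeneous wgt q (r, 0)) :
    diracOrbit c P m r q (2 * r) = q := by
  have hm' : (m : ℂ) ≠ 0 := by exact_mod_cast hm.ne'
  have hf : (r.factorial : ℂ) ≠ 0 := by exact_mod_cast r.factorial_ne_zero
  have hhalf : diracOrbit c P m r q r =
      ((m : ℂ)⁻¹ * (Real.sqrt 2 : ℂ)) ^ r • substInl (lowerT c P) q := by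
    rw [eq_smul_iterate_of_recurrence (contraction (lowerT c P) Sum.inr Sum.inl)
      ((m : ℂ)⁻¹ * (Real.sqrt 2 : ℂ)) r (diracOrbit c P m r q) fun k hk => by
        rw [diracOrbit_succ _ _ _ _ _ k (by omega), gammaOp_of_lt _ _ _ _ _ hk, smul_smul,
          mul_assoc]]
    rw [diracOrbit, contraction_inl_iterate _ hq, smul_smul, mul_assoc, inv_mul_cancel₀ hf, mul_one]
  have hmid : IsWeightedHomogeneous wgt (diracOrbit c P m r q r) (0, r) := by
    simpa [sector, xdeg] using diracOrbit_mem_sector c P m r hq r (by omega)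
  have hfull : diracOrbit c P m r q (r + r) =
      ((m : ℂ)⁻¹ * (Real.sqrt 2 : ℂ)) ^ r • substInr Pᵀ (diracOrbit c P m r q r) := by
    have := eq_smul_iterate_of_recurrence (contraction Pᵀ Sum.inl Sum.inr)
      ((m : ℂ)⁻¹ * (Real.sqrt 2 : ℂ)) r (fun k => diracOrbit c P m r q (r + k)) fun k hk => by
        change diracOrbit c P m r q (r + k + 1) = _
        rw [diracOrbit_succ _ _ _ _ _ (r + k) (by omega), gammaOp_of_le _ _ _ _ _ (by simp),
          smul_smul, mul_assoc]
        simp only [show 2 * r - (r + k) = r - k by omega]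
    rw [this, add_zero, contraction_inr_iterate _ hmid, smul_smul, mul_assoc, inv_mul_cancel₀ hf,
      mul_one]
  have hsq : (Real.sqrt 2 : ℂ) * (Real.sqrt 2 : ℂ) = 2 := by
    rw [← Complex.ofReal_mul, Real.mul_self_sqrt (by norm_num)]; norm_num
  rw [two_mul, hfull, hhalf, map_smul, substInr_substInl c P hq, smul_smul, smul_smul,
    ← mul_pow, ← mul_pow]
  have : (m : ℂ)⁻¹ * (Real.sqrt 2 : ℂ) * ((m : ℂ)⁻¹ * (Real.sqrt 2 : ℂ)) *
      (c * star c * P.det) = 1 := by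
    calc _ = (m : ℂ)⁻¹ ^ 2 * (((Real.sqrt 2 : ℂ) * (Real.sqrt 2 : ℂ)) * (c * star c * P.det)) := by
          ring
      _ = 1 := by rw [hsq, hdet, ← mul_pow, inv_mul_cancel₀ hm', one_pow]
  rw [this, one_pow, one_smul]

lemma eq_diracOrbit_of_mem_Sol {c : ℂ} {P : M2} {m : ℝ} (hm : 0 < m) {r : ℕ} (hr : 0 < r)
    {Ψ : Fin (2 * r) → PolyW} (hΨ : Ψ ∈ Sol c P m r) (n : ℕ) (h : n < 2 * r) :
    Ψ ⟨n, h⟩ = diracOrbit c P m r (Ψ ⟨0, by omega⟩) n := by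
  have hm' : (m : ℂ) ≠ 0 := by exact_mod_cast hm.ne'
  induction n with
  | zero => rfl
  | succ n ih =>
    have hn : nxt ⟨n, by omega⟩ = (⟨n + 1, h⟩ : Fin (2 * r)) := Fin.ext (Nat.mod_eq_of_lt h)
    rw [diracOrbit_succ _ _ _ _ _ n (by omega), ← ih (by omega), hΨ.2, hn, smul_smul,
      inv_mul_cancel₀ hm', one_smul]

/- STATEMENT 18: let P ∈ H with g(P,P) = m², m > 0.  Then Ψ ∈ W^{{2j}} solves
the generalized algebraic Dirac equation γ̌[P]Ψ = mΨ iff Ψ is uniquely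
determined by its main-sector component Ψ^{(2j,0)} ∈ Sym_{2j}(U) (repeated
application of (1/m)γ̌[P] generates the other sectors); the solution space is
linearly isomorphic to Sym_{2j}(U) — via Ψ ↦ Ψ^{(2j,0)} — hence of complex
dimension 2j+1.  Here r = 2j ≥ 1. -/
theorem generalized_algebraic_dirac_solutions (c : ℂ) (hc : c ≠ 0)
    (r : ℕ) (hr : 0 < r)
    (g : M2 → M2 → ℂ)
    (hg1 : ∀ M N P : M2, g (M + N) P = g M P + g N P)
    (hg2 : ∀ M N P : M2, g M (N + P) = g M N + g M P)
    (hg3 : ∀ (t : ℝ) (M N : M2), g (t • M) N = t • g M N)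
    (hg4 : ∀ (t : ℝ) (M N : M2), g M (t • N) = t • g M N)
    (hg : ∀ u v : U2, g (outerH u) (outerH v)
        = epsBil c u v * star (epsBil c u v))
    (P : M2) (hP : IsHerm P) (m : ℝ) (hm : 0 < m)
    (hmass : g P P = ((m : ℂ)) ^ 2) :
    -- the map "take the main-sector component" is a bijection from the
    -- solution set onto Sym_{2j}(U) = the bidegree-(2j,0) polynomials …
    Set.BijOn (fun Ψ : Fin (2 * r) → PolyW => Ψ ⟨0, by omega⟩)
      (Sol c P m r)
      ((weightedHomogeneousSubmodule ℂ wgt ((r : ℕ), 0) : Submodule ℂ PolyW) : Set PolyW) ∧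
    -- … hence the solution space has complex dimension 2j+1
    Module.finrank ℂ (weightedHomogeneousSubmodule ℂ wgt ((r : ℕ), 0)) = r + 1 := by
  have hm' : (m : ℂ) ≠ 0 := by exact_mod_cast hm.ne'
  have hdet : 2 * (c * star c * P.det) = (m : ℂ) ^ 2 := by
    rw [← form_self_eq_det c g hg1 hg2 hg3 hg4 hg P hP, hmass]
  refine ⟨⟨?_, ?_, ?_⟩, finrank_weightedHomogeneousSubmodule_wgt r⟩
  · intro Ψ hΨ
    simpa [sector, xdeg] using hΨ.1 ⟨0, by omega⟩
  · intro Ψ hΨ Φ hΦ h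
    funext s
    rw [eq_diracOrbit_of_mem_Sol hm hr hΨ s s.isLt, eq_diracOrbit_of_mem_Sol hm hr hΦ s s.isLt]
    exact congrArg (fun q => diracOrbit c P m r q s) h
  · intro q hq
    refine ⟨fun s => diracOrbit c P m r q s, ⟨fun s => diracOrbit_mem_sector c P m r hq s s.isLt,
      fun s => ?_⟩, rfl⟩
    have hstep : gammaOp c P r s (diracOrbit c P m r q s) =
        (m : ℂ) • diracOrbit c P m r q (s + 1) := by
      rw [diracOrbit_succ _ _ _ _ _ s s.isLt, smul_smul, mul_inv_cancel₀ hm', one_smul]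
    rw [hstep]
    change _ = (m : ℂ) • diracOrbit c P m r q (nxt s)
    rcases lt_or_ge ((s : ℕ) + 1) (2 * r) with h | h
    · rw [show ((nxt s : Fin (2 * r)) : ℕ) = s + 1 from Nat.mod_eq_of_lt h]
    · have hs : (s : ℕ) + 1 = 2 * r := by omega
      rw [show ((nxt s : Fin (2 * r)) : ℕ) = 0 by simp [nxt, hs], hs,
        diracOrbit_two_mul c P m hm r hr hdet hq, diracOrbit]
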